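/- Let f : ℝ² → ℝ be given by f(x,y) = xy + (1/24)(ax⁴ + 4bx³y + 6ex²y² + 4cxy³ + dy⁴) + R(x,y), where a, b, c, d, e are real numbers and R : ℝ² → ℝ is smooth with all partial derivatives of order ≤ 4 vanishing at the origin. Then, as (x,y) → (0,0), F₁₁₁(f)(x,y) + (ax + by) = O(‖(x,y)‖²), F₂₂₂(f)(x,y) + (cx + dy) = O(‖(x,y)‖²), F₁₁₂(f)(x,y) = O(‖(x,y)‖²), and F₁₂₂(f)(x,y) = O(‖(x,y)‖²). -/

import Mathlib

open Topology Asymptotics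

/-- Partial derivative in the first variable. -/
noncomputable def pdx (f : ℝ → ℝ → ℝ) : ℝ → ℝ → ℝ := fun x y => deriv (fun x' => f x' y) x

/-- Partial derivative in the second variable. -/
noncomputable def pdy (f : ℝ → ℝ → ℝ) : ℝ → ℝ → ℝ := fun x y => deriv (fun y' => f x y') y

/-- φ⁵·C₁₁₁ component of the affine cubic form of the graph of `f`. -/
noncomputable def F111 (f : ℝ → ℝ → ℝ) (x y : ℝ) : ℝ :=
  (1/4) * pdx (pdx (pdx f)) x y * pdx (pdx f) x y * pdy (pdy f) x y
  - (3/4) * pdy (pdy (pdx f)) x y * (pdx (pdx f) x y)^2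
  + (3/2) * pdy (pdx (pdx f)) x y * pdx (pdx f) x y * pdy (pdx f) x y
  - pdx (pdx (pdx f)) x y * (pdy (pdx f) x y)^2

/-- φ⁵·C₁₁₂ component of the affine cubic form of the graph of `f`. -/
noncomputable def F112 (f : ℝ → ℝ → ℝ) (x y : ℝ) : ℝ :=
  -(1/4) * (pdx (pdx f) x y)^2 * pdy (pdy (pdy f)) x y
  + (3/4) * pdx (pdx f) x y * pdy (pdy f) x y * pdy (pdx (pdx f)) x y
  - (1/2) * pdy (pdx f) x y * pdy (pdy f) x y * pdx (pdx (pdx f)) x y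

/-- φ⁵·C₁₂₂ component of the affine cubic form of the graph of `f`. -/
noncomputable def F122 (f : ℝ → ℝ → ℝ) (x y : ℝ) : ℝ :=
  -(1/4) * (pdy (pdy f) x y)^2 * pdx (pdx (pdx f)) x y
  + (3/4) * pdx (pdx f) x y * pdy (pdy f) x y * pdy (pdy (pdx f)) x y
  - (1/2) * pdy (pdx f) x y * pdx (pdx f) x y * pdy (pdy (pdy f)) x y

/-- φ⁵·C₂₂₂ component of the affine cubic form of the graph of `f`. -/
noncomputable def F222 (f : ℝ → ℝ → ℝ) (x y : ℝ) : ℝ :=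
  (1/4) * pdy (pdy (pdy f)) x y * pdx (pdx f) x y * pdy (pdy f) x y
  - (3/4) * pdy (pdx (pdx f)) x y * (pdy (pdy f) x y)^2
  + (3/2) * pdy (pdy (pdx f)) x y * pdy (pdy f) x y * pdy (pdx f) x y
  - pdy (pdy (pdy f)) x y * (pdy (pdx f) x y)^2

/-- `R`, as a function on the plane, is smooth and its derivatives of order at most `n` vanish at
the origin. -/
def FlatToOrder (n : ℕ) (R : ℝ → ℝ → ℝ) : Prop :=
  ContDiff ℝ (⊤ : ℕ∞) (fun p : ℝ × ℝ => R p.1 p.2) ∧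
    ∀ k ≤ n, iteratedFDeriv ℝ k (fun p : ℝ × ℝ => R p.1 p.2) (0, 0) = 0

theorem pdx_eq_fderiv {R : ℝ → ℝ → ℝ} (hR : Differentiable ℝ (fun p : ℝ × ℝ => R p.1 p.2))
    (x y : ℝ) : pdx R x y = fderiv ℝ (fun p : ℝ × ℝ => R p.1 p.2) (x, y) (1, 0) :=
  ((hR (x, y)).hasFDerivAt.comp_hasDerivAt (f := fun t : ℝ => (t, y)) x
    ((hasDerivAt_id x).prodMk (hasDerivAt_const x y))).deriv

theorem pdy_eq_fderiv {R : ℝ → ℝ → ℝ} (hR : Differentiable ℝ (fun p : ℝ × ℝ => R p.1 p.2))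
    (x y : ℝ) : pdy R x y = fderiv ℝ (fun p : ℝ × ℝ => R p.1 p.2) (x, y) (0, 1) :=
  ((hR (x, y)).hasFDerivAt.comp_hasDerivAt (f := fun t : ℝ => (x, t)) y
    ((hasDerivAt_const y x).prodMk (hasDerivAt_id y))).deriv

theorem pdx_add {f P P' R : ℝ → ℝ → ℝ} (hR : Differentiable ℝ (fun p : ℝ × ℝ => R p.1 p.2))
    (hf : ∀ x y, f x y = P x y + R x y)
    (hP : ∀ x y, HasDerivAt (fun t => P t y) (P' x y) x) (x y : ℝ) :
    pdx f x y = P' x y + pdx R x y := by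
  have hRx : DifferentiableAt ℝ (fun t => R t y) x :=
    (hR (x, y)).comp (f := fun t : ℝ => (t, y)) x (by fun_prop)
  simp only [pdx, hf]
  exact ((hP x y).add hRx.hasDerivAt).deriv

theorem pdy_add {f P P' R : ℝ → ℝ → ℝ} (hR : Differentiable ℝ (fun p : ℝ × ℝ => R p.1 p.2))
    (hf : ∀ x y, f x y = P x y + R x y)
    (hP : ∀ x y, HasDerivAt (fun t => P x t) (P' x y) y) (x y : ℝ) :
    pdy f x y = P' x y + pdy R x y := by
  have hRy : DifferentiableAt ℝ (fun t => R x t) y :=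
    (hR (x, y)).comp (f := fun t : ℝ => (x, t)) y (by fun_prop)
  simp only [pdy, hf]
  exact ((hP x y).add hRy.hasDerivAt).deriv

namespace FlatToOrder

variable {n : ℕ} {R : ℝ → ℝ → ℝ}

theorem differentiable (h : FlatToOrder n R) :
    Differentiable ℝ (fun p : ℝ × ℝ => R p.1 p.2) :=
  h.1.differentiable (by simp)

theorem apply_zero (h : FlatToOrder n R) : R 0 0 = 0 := by
  have := congrArg (fun m => m 0) (h.2 0 n.zero_le)
  simpa using this

theorem of_fderiv_apply {S : ℝ → ℝ → ℝ} (h : FlatToOrder (n + 1) R) (v : ℝ × ℝ)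
    (hS : ∀ x y, S x y = fderiv ℝ (fun p : ℝ × ℝ => R p.1 p.2) (x, y) v) :
    FlatToOrder n S := by
  have hfd : ContDiff ℝ (⊤ : ℕ∞) (fderiv ℝ (fun p : ℝ × ℝ => R p.1 p.2)) :=
    h.1.fderiv_right (by simp)
  have hS' : (fun p : ℝ × ℝ => S p.1 p.2) =
      ContinuousLinearMap.apply ℝ ℝ v ∘ fderiv ℝ (fun p : ℝ × ℝ => R p.1 p.2) := by
    ext p
    simp [hS]
  rw [FlatToOrder, hS']
  refine ⟨(ContinuousLinearMap.contDiff _).comp hfd, fun k hk => ?_⟩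
  have hzero : iteratedFDeriv ℝ k (fderiv ℝ (fun p : ℝ × ℝ => R p.1 p.2)) (0, 0) = 0 := by
    rw [← norm_eq_zero, norm_iteratedFDeriv_fderiv, h.2 (k + 1) (by omega), norm_zero]
  rw [ContinuousLinearMap.iteratedFDeriv_comp_left _ hfd.contDiffAt (by exact_mod_cast le_top),
    hzero]
  ext m
  simp

theorem pdx (h : FlatToOrder (n + 1) R) : FlatToOrder n (pdx R) :=
  h.of_fderiv_apply (1, 0) (pdx_eq_fderiv h.differentiable)

theorem pdy (h : FlatToOrder (n + 1) R) : FlatToOrder n (pdy R) :=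
  h.of_fderiv_apply (0, 1) (pdy_eq_fderiv h.differentiable)

end FlatToOrder

section Asymptotics

variable {E F : Type*} [NormedAddCommGroup E] [NormedSpace ℝ E] [NormedAddCommGroup F]
  [NormedSpace ℝ F]

theorem DifferentiableAt.isBigO_norm_of_map_zero {g : E → F} (hg : DifferentiableAt ℝ g 0)
    (h0 : g 0 = 0) : g =O[𝓝 0] (fun p => ‖p‖) := by
  simpa [h0] using hg.isBigO_sub.norm_right

theorem isBigO_norm_sq_of_fderiv {g : E → F} (hg : Differentiable ℝ g) (h0 : g 0 = 0)
    (hg' : fderiv ℝ g =O[𝓝 0] (fun p => ‖p‖)) : g =O[𝓝 0] (fun p => ‖p‖ ^ 2) := by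
  obtain ⟨C, hC, hb⟩ := hg'.exists_pos
  obtain ⟨ε, hε, hball⟩ := Metric.eventually_nhds_iff_ball.1 hb.bound
  refine IsBigO.of_bound C (Metric.eventually_nhds_iff_ball.2 ⟨ε, hε, fun p hp => ?_⟩)
  have hp' : ‖p‖ < ε := by simpa using hp
  have key := (convex_closedBall (0 : E) ‖p‖).norm_image_sub_le_of_norm_fderiv_le
    (f := g) (C := C * ‖p‖) (𝕜 := ℝ) (x := 0) (y := p) (fun q _ => hg q)
    (fun q hq => by
      have hq' : ‖q‖ ≤ ‖p‖ := by simpa using hq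
      have := hball q (by simpa using hq'.trans_lt hp')
      rw [norm_norm] at this
      exact this.trans (by gcongr)) (by simp) (by simp)
  simpa [h0, pow_two, mul_assoc] using key

end Asymptotics

theorem FlatToOrder.isBigO_norm_sq {R : ℝ → ℝ → ℝ} (h : FlatToOrder 1 R) :
    (fun p : ℝ × ℝ => R p.1 p.2) =O[𝓝 0] (fun p => ‖p‖ ^ 2) := by
  refine isBigO_norm_sq_of_fderiv h.differentiable h.apply_zero ?_
  refine DifferentiableAt.isBigO_norm_of_map_zero
    ((h.1.fderiv_right (m := (⊤ : ℕ∞)) (by simp)).differentiable (by simp) 0) ?_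
  rw [← norm_eq_zero, ← norm_iteratedFDeriv_one]
  exact norm_eq_zero.2 (h.2 1 le_rfl)

section CubicFormShape

variable {α : Type*} {l : Filter α} {r T A B U V W L : α → ℝ}

/-- The shape shared by `F111` and `F222`. -/
theorem isBigO_sq_of_diagonal_shape (hr : r =O[l] (fun _ => (1 : ℝ)))
    (hT : T =O[l] r) (hA : A =O[l] r) (hB : B =O[l] r) (hU : U =O[l] r) (hV : V =O[l] r)
    (hW : (fun p => W p - 1) =O[l] r) (hTL : (fun p => T p - L p) =O[l] (fun p => r p ^ 2)) :
    (fun p => (1/4) * T p * A p * B p - (3/4) * U p * A p ^ 2 + (3/2) * V p * A p * W p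
      - T p * W p ^ 2 + L p) =O[l] (fun p => r p ^ 2) := by
  have hW1 : W =O[l] (fun _ => (1 : ℝ)) := by
    simpa using (hW.trans hr).add (isBigO_refl (fun _ => (1 : ℝ)) l)
  have h1 := (((hT.mul hA).mul (hB.trans hr)).const_mul_left (1/4))
  have h2 := (((hU.mul hA).mul (hA.trans hr)).const_mul_left (3/4))
  have h3 := (((hV.mul hA).mul hW1).const_mul_left (3/2))
  have h4 := (hT.mul hW).mul (hW1.add (isBigO_refl (fun _ => (1 : ℝ)) l))
  simp only [mul_one, ← pow_two] at h1 h2 h3 h4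
  refine ((((h1.sub h2).add h3).sub h4).sub hTL).congr_left fun p => ?_
  ring

/-- The shape shared by `F112` and `F122`. -/
theorem isBigO_sq_of_mixed_shape (hr : r =O[l] (fun _ => (1 : ℝ)))
    (hT : T =O[l] r) (hA : A =O[l] r) (hB : B =O[l] r) (hU : U =O[l] r) (hV : V =O[l] r)
    (hW : (fun p => W p - 1) =O[l] r) :
    (fun p => -(1/4) * A p ^ 2 * T p + (3/4) * A p * B p * U p - (1/2) * W p * B p * V p)
      =O[l] (fun p => r p ^ 2) := by
  have hW1 : W =O[l] (fun _ => (1 : ℝ)) := by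
    simpa using (hW.trans hr).add (isBigO_refl (fun _ => (1 : ℝ)) l)
  have h1 := (((hA.mul hA).mul (hT.trans hr)).const_mul_left (-(1/4)))
  have h2 := (((hA.mul hB).mul (hU.trans hr)).const_mul_left (3/4))
  have h3 := (((hB.mul hV).mul hW1).const_mul_left (1/2))
  simp only [mul_one, ← pow_two] at h1 h2 h3
  refine ((h1.add h2).sub h3).congr_left fun p => ?_
  ring

end CubicFormShape

theorem hasDerivAt_of_eq_quartic {g : ℝ → ℝ} {g' x : ℝ} (c₀ c₁ c₂ c₃ c₄ : ℝ)
    (hg : ∀ t, g t = c₀ + c₁ * t + c₂ * t ^ 2 + c₃ * t ^ 3 + c₄ * t ^ 4)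
    (hg' : g' = c₁ + 2 * c₂ * x + 3 * c₃ * x ^ 2 + 4 * c₄ * x ^ 3) : HasDerivAt g g' x := by
  rw [funext hg, hg']
  refine (((((hasDerivAt_const x c₀).add ((hasDerivAt_id' x).const_mul c₁)).add
    ((hasDerivAt_pow 2 x).const_mul c₂)).add ((hasDerivAt_pow 3 x).const_mul c₃)).add
    ((hasDerivAt_pow 4 x).const_mul c₄)).congr_deriv ?_
  norm_num
  ring

theorem cubic_form_hyperbolic_first_order
    (a b c d e : ℝ) (R f : ℝ → ℝ → ℝ)
    (hR : ContDiff ℝ (⊤ : ℕ∞) (fun p : ℝ × ℝ => R p.1 p.2))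
    (hRvan : ∀ k : ℕ, k ≤ 4 → iteratedFDeriv ℝ k (fun p : ℝ × ℝ => R p.1 p.2) (0, 0) = 0)
    (hf : ∀ x y : ℝ, f x y = x*y
      + (1/24)*(a*x^4 + 4*b*x^3*y + 6*e*x^2*y^2 + 4*c*x*y^3 + d*y^4) + R x y) :
    (fun p : ℝ × ℝ => F111 f p.1 p.2 + (a*p.1 + b*p.2))
        =O[𝓝 (0 : ℝ × ℝ)] (fun p : ℝ × ℝ => ‖p‖^2) ∧
    (fun p : ℝ × ℝ => F222 f p.1 p.2 + (c*p.1 + d*p.2))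
        =O[𝓝 (0 : ℝ × ℝ)] (fun p : ℝ × ℝ => ‖p‖^2) ∧
    (fun p : ℝ × ℝ => F112 f p.1 p.2)
        =O[𝓝 (0 : ℝ × ℝ)] (fun p : ℝ × ℝ => ‖p‖^2) ∧
    (fun p : ℝ × ℝ => F122 f p.1 p.2)
        =O[𝓝 (0 : ℝ × ℝ)] (fun p : ℝ × ℝ => ‖p‖^2) := by
  have hR0 : FlatToOrder 4 R := ⟨hR, hRvan⟩
  have hx : ∀ x y, pdx f x y = (y + (1/6)*(a*x^3 + 3*b*x^2*y + 3*e*x*y^2 + c*y^3)) + pdx R x y :=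
    pdx_add hR0.differentiable hf fun x y =>
      hasDerivAt_of_eq_quartic (d*y^4/24) (y + c*y^3/6) (e*y^2/4) (b*y/6) (a/24)
        (fun _ => by ring) (by ring)
  have hy : ∀ x y, pdy f x y = (x + (1/6)*(b*x^3 + 3*e*x^2*y + 3*c*x*y^2 + d*y^3)) + pdy R x y :=
    pdy_add hR0.differentiable hf fun x y =>
      hasDerivAt_of_eq_quartic (a*x^4/24) (x + b*x^3/6) (e*x^2/4) (c*x/6) (d/24)
        (fun _ => by ring) (by ring)
  have hxx : ∀ x y, pdx (pdx f) x y = (1/2)*(a*x^2 + 2*b*x*y + e*y^2) + pdx (pdx R) x y :=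
    pdx_add hR0.pdx.differentiable hx fun x y =>
      hasDerivAt_of_eq_quartic (y + c*y^3/6) (e*y^2/2) (b*y/2) (a/6) 0
        (fun _ => by ring) (by ring)
  have hxy : ∀ x y, pdy (pdx f) x y = (1 + (1/2)*(b*x^2 + 2*e*x*y + c*y^2)) + pdy (pdx R) x y :=
    pdy_add hR0.pdx.differentiable hx fun x y =>
      hasDerivAt_of_eq_quartic (a*x^3/6) (1 + b*x^2/2) (e*x/2) (c/6) 0
        (fun _ => by ring) (by ring)
  have hyy : ∀ x y, pdy (pdy f) x y = (1/2)*(e*x^2 + 2*c*x*y + d*y^2) + pdy (pdy R) x y :=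
    pdy_add hR0.pdy.differentiable hy fun x y =>
      hasDerivAt_of_eq_quartic (x + b*x^3/6) (e*x^2/2) (c*x/2) (d/6) 0
        (fun _ => by ring) (by ring)
  have hxxx : ∀ x y, pdx (pdx (pdx f)) x y = (a*x + b*y) + pdx (pdx (pdx R)) x y :=
    pdx_add hR0.pdx.pdx.differentiable hxx fun x y =>
      hasDerivAt_of_eq_quartic (e*y^2/2) (b*y) (a/2) 0 0
        (fun _ => by ring) (by ring)
  have hxxy : ∀ x y, pdy (pdx (pdx f)) x y = (b*x + e*y) + pdy (pdx (pdx R)) x y :=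
    pdy_add hR0.pdx.pdx.differentiable hxx fun x y =>
      hasDerivAt_of_eq_quartic (a*x^2/2) (b*x) (e/2) 0 0
        (fun _ => by ring) (by ring)
  have hxyy : ∀ x y, pdy (pdy (pdx f)) x y = (e*x + c*y) + pdy (pdy (pdx R)) x y :=
    pdy_add hR0.pdx.pdy.differentiable hxy fun x y =>
      hasDerivAt_of_eq_quartic (1 + b*x^2/2) (e*x) (c/2) 0 0
        (fun _ => by ring) (by ring)
  have hyyy : ∀ x y, pdy (pdy (pdy f)) x y = (c*x + d*y) + pdy (pdy (pdy R)) x y :=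
    pdy_add hR0.pdy.pdy.differentiable hyy fun x y =>
      hasDerivAt_of_eq_quartic (e*x^2/2) (c*x) (d/2) 0 0
        (fun _ => by ring) (by ring)
  have hr : (fun p : ℝ × ℝ => ‖p‖) =O[𝓝 0] (fun _ => (1 : ℝ)) :=
    (continuous_norm.tendsto (0 : ℝ × ℝ)).isBigO_one ℝ
  have oxx : (fun p : ℝ × ℝ => pdx (pdx f) p.1 p.2) =O[𝓝 0] (fun p => ‖p‖) := by
    have hd := hR0.pdx.pdx.differentiable
    have h0 := hR0.pdx.pdx.apply_zero
    refine DifferentiableAt.isBigO_norm_of_map_zero ?_ (by simp [hxx, h0])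
    simp only [hxx]
    fun_prop
  have oxy : (fun p : ℝ × ℝ => pdy (pdx f) p.1 p.2 - 1) =O[𝓝 0] (fun p => ‖p‖) := by
    have hd := hR0.pdx.pdy.differentiable
    have h0 := hR0.pdx.pdy.apply_zero
    refine DifferentiableAt.isBigO_norm_of_map_zero ?_ (by simp [hxy, h0])
    simp only [hxy]
    fun_prop
  have oyy : (fun p : ℝ × ℝ => pdy (pdy f) p.1 p.2) =O[𝓝 0] (fun p => ‖p‖) := by
    have hd := hR0.pdy.pdy.differentiable
    have h0 := hR0.pdy.pdy.apply_zero
    refine DifferentiableAt.isBigO_norm_of_map_zero ?_ (by simp [hyy, h0])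
    simp only [hyy]
    fun_prop
  have oxxx : (fun p : ℝ × ℝ => pdx (pdx (pdx f)) p.1 p.2) =O[𝓝 0] (fun p => ‖p‖) := by
    have hd := hR0.pdx.pdx.pdx.differentiable
    have h0 := hR0.pdx.pdx.pdx.apply_zero
    refine DifferentiableAt.isBigO_norm_of_map_zero ?_ (by simp [hxxx, h0])
    simp only [hxxx]
    fun_prop
  have oxxy : (fun p : ℝ × ℝ => pdy (pdx (pdx f)) p.1 p.2) =O[𝓝 0] (fun p => ‖p‖) := by
    have hd := hR0.pdx.pdx.pdy.differentiable
    have h0 := hR0.pdx.pdx.pdy.apply_zero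
    refine DifferentiableAt.isBigO_norm_of_map_zero ?_ (by simp [hxxy, h0])
    simp only [hxxy]
    fun_prop
  have oxyy : (fun p : ℝ × ℝ => pdy (pdy (pdx f)) p.1 p.2) =O[𝓝 0] (fun p => ‖p‖) := by
    have hd := hR0.pdx.pdy.pdy.differentiable
    have h0 := hR0.pdx.pdy.pdy.apply_zero
    refine DifferentiableAt.isBigO_norm_of_map_zero ?_ (by simp [hxyy, h0])
    simp only [hxyy]
    fun_prop
  have oyyy : (fun p : ℝ × ℝ => pdy (pdy (pdy f)) p.1 p.2) =O[𝓝 0] (fun p => ‖p‖) := by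
    have hd := hR0.pdy.pdy.pdy.differentiable
    have h0 := hR0.pdy.pdy.pdy.apply_zero
    refine DifferentiableAt.isBigO_norm_of_map_zero ?_ (by simp [hyyy, h0])
    simp only [hyyy]
    fun_prop
  have oxxx' : (fun p : ℝ × ℝ => pdx (pdx (pdx f)) p.1 p.2 - (a*p.1 + b*p.2))
      =O[𝓝 0] (fun p => ‖p‖ ^ 2) := by
    simpa [hxxx] using hR0.pdx.pdx.pdx.isBigO_norm_sq
  have oyyy' : (fun p : ℝ × ℝ => pdy (pdy (pdy f)) p.1 p.2 - (c*p.1 + d*p.2))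
      =O[𝓝 0] (fun p => ‖p‖ ^ 2) := by
    simpa [hyyy] using hR0.pdy.pdy.pdy.isBigO_norm_sq
  refine ⟨isBigO_sq_of_diagonal_shape hr oxxx oxx oyy oxyy oxxy oxy oxxx', ?_,
    isBigO_sq_of_mixed_shape hr oyyy oxx oyy oxxy oxxx oxy, ?_⟩
  · refine (isBigO_sq_of_diagonal_shape hr oyyy oyy oxx oxxy oxyy oxy oyyy').congr_left fun p => ?_
    simp only [F222]
    ring
  · refine (isBigO_sq_of_mixed_shape hr oxxx oyy oxx oxyy oyyy oxy).congr_left fun p => ?_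
    simp only [F122]
    ring
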